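/- Let φ : [0,∞) → [0,∞) be differentiable with nondecreasing derivative φ', with φ(0) = 0, and let 1 < p₁ ≤ p₂ be such that p₁·φ(t) ≤ t·φ'(t) ≤ p₂·φ(t) for all t > 0. For s ≥ 0 define the shifted function φ_s(t) = ∫₀^t φ'(s+τ)·τ/(s+τ) dτ. Then there exists a constant c ≥ 1, depending only on p₁ and p₂, such that for all s ≥ 0 and t ≥ 0 with s + t > 0: c^{−1}·(φ'(s+t)/(s+t))·t² ≤ φ_s(t) ≤ c·(φ'(s+t)/(s+t))·t² and c^{−1}·(φ(s+t)/(s+t)²)·t² ≤ φ_s(t) ≤ c·(φ(s+t)/(s+t)²)·t². -/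

import Mathlib

/-- A nonnegative function with `t φ' t ≤ p φ t` grows at most by the factor `exp p` when its
argument is doubled. -/
lemma le_exp_mul_half_of_mul_deriv_le {φ φ' : ℝ → ℝ} {p u : ℝ} (hp : 0 ≤ p) (hu : 0 < u)
    (hnn : ∀ t ∈ Set.Ici (0 : ℝ), 0 ≤ φ t)
    (hd : ∀ t ∈ Set.Ici (0 : ℝ), HasDerivWithinAt φ (φ' t) (Set.Ici 0) t)
    (hidx : ∀ t > (0 : ℝ), t * φ' t ≤ p * φ t) :
    φ u ≤ Real.exp p * φ (u / 2) := by
  have hderiv : ∀ x > (0 : ℝ), HasDerivAt (fun x => φ x * Real.exp (-(2 * p / u) * x))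
      (φ' x * Real.exp (-(2 * p / u) * x) +
        φ x * (Real.exp (-(2 * p / u) * x) * (-(2 * p / u) * 1))) x := by
    intro x hx
    exact ((hd x hx.le).hasDerivAt (Ici_mem_nhds hx)).mul
      (((hasDerivAt_id x).const_mul (-(2 * p / u))).exp)
  have hanti : AntitoneOn (fun x => φ x * Real.exp (-(2 * p / u) * x)) (Set.Icc (u / 2) u) := by
    apply antitoneOn_of_deriv_nonpos (convex_Icc _ _)
    · intro x hx
      exact (hderiv x (by linarith [hx.1])).continuousAt.continuousWithinAt
    · intro x hx
      rw [interior_Icc] at hx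
      exact (hderiv x (by linarith [hx.1])).differentiableAt.differentiableWithinAt
    · intro x hx
      rw [interior_Icc] at hx
      have hx0 : 0 < x := by linarith [hx.1]
      rw [(hderiv x hx0).deriv]
      have hφ' : φ' x ≤ 2 * p / u * φ x := by
        have h1 : φ' x ≤ p * φ x / x := by
          rw [le_div_iff₀ hx0]
          linarith [hidx x hx0]
        have h2 : p * φ x / x ≤ p * φ x / (u / 2) :=
          div_le_div_of_nonneg_left (mul_nonneg hp (hnn x hx0.le)) (by linarith) hx.1.le
        have h3 : p * φ x / (u / 2) = 2 * p / u * φ x := by field_simp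
        linarith
      nlinarith [Real.exp_pos (-(2 * p / u) * x)]
  have h := hanti (Set.left_mem_Icc.2 (by linarith)) (Set.right_mem_Icc.2 (by linarith))
    (by linarith : u / 2 ≤ u)
  have e1 : -(2 * p / u) * u = -p + -p := by field_simp; ring
  have e2 : -(2 * p / u) * (u / 2) = -p := by field_simp
  simp only [e1, e2, Real.exp_add] at h
  have h' : φ u * Real.exp (-p) ≤ φ (u / 2) :=
    le_of_mul_le_mul_right (by linarith) (Real.exp_pos (-p))
  rw [Real.exp_neg, ← div_eq_mul_inv, div_le_iff₀ (Real.exp_pos p)] at h'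
  linarith

/-- The integrand of a shifted function is nondecreasing. -/
lemma monotoneOn_shifted_integrand {g : ℝ → ℝ} {s : ℝ} (hs : 0 ≤ s)
    (hg : MonotoneOn g (Set.Ici 0)) (hg0 : ∀ t > (0 : ℝ), 0 ≤ g t) :
    MonotoneOn (fun τ => g (s + τ) * τ / (s + τ)) (Set.Ici 0) := by
  intro a ha b hb hab
  have ha : 0 ≤ a := ha
  have hb : 0 ≤ b := hb
  rcases ha.eq_or_lt with rfl | ha'
  · rcases hb.eq_or_lt with rfl | hb'
    · exact le_rfl
    · have := hg0 (s + b) (by linarith)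
      simp only [mul_zero, zero_div]
      positivity
  · have h1 : g (s + a) ≤ g (s + b) :=
      hg (add_nonneg hs ha) (add_nonneg hs hb) (by linarith)
    have h2 : a / (s + a) ≤ b / (s + b) := by
      rw [div_le_div_iff₀ (by linarith) (by linarith)]
      nlinarith
    simp only [mul_div_assoc]
    exact mul_le_mul h1 h2 (by positivity) (hg0 _ (by linarith))

/-- The integral of a nondecreasing nonnegative function over `[0, t]` lies between
`t / 2 * f (t / 2)` and `t * f t`. -/
lemma integral_bounds_of_monotoneOn {f : ℝ → ℝ} {t : ℝ} (ht : 0 ≤ t)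
    (hf : MonotoneOn f (Set.Ici 0)) (hf0 : 0 ≤ f 0) :
    t / 2 * f (t / 2) ≤ ∫ τ in (0 : ℝ)..t, f τ ∧ ∫ τ in (0 : ℝ)..t, f τ ≤ t * f t := by
  have hint : ∀ a b : ℝ, 0 ≤ a → a ≤ b → IntervalIntegrable f MeasureTheory.volume a b := by
    intro a b ha hab
    apply MonotoneOn.intervalIntegrable
    rw [Set.uIcc_of_le hab]
    exact hf.mono fun x hx => ha.trans hx.1
  have ht2 : 0 ≤ t / 2 := by linarith
  constructor
  · rw [← intervalIntegral.integral_add_adjacent_intervals (hint 0 (t / 2) le_rfl ht2)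
      (hint (t / 2) t ht2 (by linarith))]
    have h1 : 0 ≤ ∫ τ in (0 : ℝ)..(t / 2), f τ :=
      intervalIntegral.integral_nonneg ht2 fun x hx =>
        hf0.trans (hf (Set.mem_Ici.2 le_rfl) hx.1 hx.1)
    have h2 : ∫ _τ in (t / 2)..t, f (t / 2) ≤ ∫ τ in (t / 2)..t, f τ :=
      intervalIntegral.integral_mono_on (by linarith) (by simp) (hint _ _ ht2 (by linarith))
        fun x hx => hf ht2 (ht2.trans hx.1) hx.1
    rw [intervalIntegral.integral_const, smul_eq_mul] at h2
    linarith
  · have h2 : ∫ τ in (0 : ℝ)..t, f τ ≤ ∫ _τ in (0 : ℝ)..t, f t :=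
      intervalIntegral.integral_mono_on ht (hint _ _ le_rfl ht) (by simp)
        fun x hx => hf hx.1 ht hx.2
    rw [intervalIntegral.integral_const, smul_eq_mul] at h2
    linarith

/-- for an N-function `φ` with indices `p₁ ≤ p₂` and nondecreasing
derivative, the shifted function satisfies
`φ_s(t) ∼ (φ'(s+t)/(s+t))·t² ∼ (φ(s+t)/(s+t)²)·t²` whenever `s + t > 0`,
with constants depending only on `p₁, p₂`. -/
theorem stmt_13 (p₁ p₂ : ℝ) (hp₁ : 1 < p₁) (hp : p₁ ≤ p₂) :
    ∃ c : ℝ, 1 ≤ c ∧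
      ∀ (φ φ' : ℝ → ℝ),
        φ 0 = 0 →
        (∀ t ∈ Set.Ici (0 : ℝ), 0 ≤ φ t) →
        (∀ t ∈ Set.Ici (0 : ℝ), HasDerivWithinAt φ (φ' t) (Set.Ici 0) t) →
        MonotoneOn φ' (Set.Ici 0) →
        (∀ t > (0 : ℝ), p₁ * φ t ≤ t * φ' t ∧ t * φ' t ≤ p₂ * φ t) →
      ∀ s ≥ (0 : ℝ), ∀ t ≥ (0 : ℝ), 0 < s + t →
        (c⁻¹ * (φ' (s + t) / (s + t) * t ^ 2) ≤
            (∫ τ in (0 : ℝ)..t, φ' (s + τ) * τ / (s + τ)) ∧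
          (∫ τ in (0 : ℝ)..t, φ' (s + τ) * τ / (s + τ)) ≤
            c * (φ' (s + t) / (s + t) * t ^ 2)) ∧
        (c⁻¹ * (φ (s + t) / (s + t) ^ 2 * t ^ 2) ≤
            (∫ τ in (0 : ℝ)..t, φ' (s + τ) * τ / (s + τ)) ∧
          (∫ τ in (0 : ℝ)..t, φ' (s + τ) * τ / (s + τ)) ≤
            c * (φ (s + t) / (s + t) ^ 2 * t ^ 2)) := by
  have hp2 : 1 < p₂ := hp₁.trans_le hp
  have hK : 1 ≤ Real.exp p₂ := Real.one_le_exp (by linarith)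
  have hc : p₂ ≤ 4 * p₂ * Real.exp p₂ := by nlinarith
  refine ⟨4 * p₂ * Real.exp p₂, by linarith, ?_⟩
  intro φ φ' _ hnn hd hmono hidx s hs t ht hst
  have hφ'0 : ∀ x > (0 : ℝ), 0 ≤ φ' x := by
    intro x hx
    have h := (hidx x hx).1
    have h' : 0 ≤ p₁ * φ x := mul_nonneg (by linarith) (hnn x hx.le)
    exact nonneg_of_mul_nonneg_right (h'.trans h) hx
  have hgrow : φ (s + t) ≤ Real.exp p₂ * φ ((s + t) / 2) :=
    le_exp_mul_half_of_mul_deriv_le (by linarith) hst hnn hd fun x hx => (hidx x hx).2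
  obtain ⟨hlo, hup⟩ := integral_bounds_of_monotoneOn ht
    (monotoneOn_shifted_integrand hs hmono hφ'0) (by simp)
  set I := ∫ τ in (0 : ℝ)..t, φ' (s + τ) * τ / (s + τ)
  have hhalf : φ' ((s + t) / 2) ≤ φ' (s + t / 2) :=
    hmono (Set.mem_Ici.2 (by linarith)) (Set.mem_Ici.2 (by linarith)) (by linarith)
  have hfrac : t / 2 / (s + t) ≤ t / 2 / (s + t / 2) := by
    rcases ht.eq_or_lt with rfl | ht'
    · simp
    · exact div_le_div_of_nonneg_left (by linarith) (by linarith) (by linarith)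
  obtain ⟨hu1, hu2⟩ := hidx (s + t) hst
  have hv1 := (hidx ((s + t) / 2) (by linarith)).1
  have hu0 := hφ'0 (s + t) hst
  have hv0 := hφ'0 ((s + t) / 2) (by linarith)
  have hφu := hnn (s + t) hst.le
  have hφv := hnn ((s + t) / 2) (by simp only [Set.mem_Ici]; linarith)
  have hdouble : 4 * φ' (s + t) ≤ 4 * p₂ * Real.exp p₂ * φ' ((s + t) / 2) := by
    have h1 : φ ((s + t) / 2) ≤ (s + t) / 2 * φ' ((s + t) / 2) := by nlinarith
    have h2 : (s + t) * φ' (s + t) ≤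
        p₂ * (Real.exp p₂ * ((s + t) / 2 * φ' ((s + t) / 2))) :=
      hu2.trans (mul_le_mul_of_nonneg_left
        (hgrow.trans (mul_le_mul_of_nonneg_left h1 (by linarith))) (by linarith))
    refine le_of_mul_le_mul_left ?_ hst
    have h3 : 0 ≤ p₂ * (Real.exp p₂ * ((s + t) / 2 * φ' ((s + t) / 2))) := by positivity
    linarith
  have hcpos : 0 < 4 * p₂ * Real.exp p₂ := by linarith
  have hlower : φ' (s + t) / (s + t) * t ^ 2 ≤ 4 * p₂ * Real.exp p₂ * I := by
    have h1 : t / 2 * (φ' ((s + t) / 2) * (t / 2 / (s + t))) ≤ I := by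
      refine le_trans ?_ hlo
      simp only [mul_div_assoc]
      exact mul_le_mul_of_nonneg_left (mul_le_mul hhalf hfrac (by positivity)
        (hv0.trans hhalf)) (by linarith)
    have h2 := mul_le_mul_of_nonneg_left h1 hcpos.le
    have h3 := mul_le_mul_of_nonneg_right hdouble (show 0 ≤ t ^ 2 / (4 * (s + t)) by positivity)
    have e1 : 4 * φ' (s + t) * (t ^ 2 / (4 * (s + t))) = φ' (s + t) / (s + t) * t ^ 2 := by
      field_simp
    have e2 : 4 * p₂ * Real.exp p₂ * (t / 2 * (φ' ((s + t) / 2) * (t / 2 / (s + t)))) =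
        4 * p₂ * Real.exp p₂ * φ' ((s + t) / 2) * (t ^ 2 / (4 * (s + t))) := by
      field_simp
      ring
    linarith
  have hupper : I ≤ φ' (s + t) / (s + t) * t ^ 2 := by
    refine hup.trans (le_of_eq ?_)
    ring
  have hA : φ (s + t) / (s + t) ^ 2 * t ^ 2 ≤ φ' (s + t) / (s + t) * t ^ 2 := by
    refine mul_le_mul_of_nonneg_right ?_ (by positivity)
    rw [div_le_div_iff₀ (by positivity) hst]
    have h : φ (s + t) ≤ (s + t) * φ' (s + t) := by nlinarith
    linarith [mul_le_mul_of_nonneg_right h hst.le]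
  have hB : φ' (s + t) / (s + t) * t ^ 2 ≤ p₂ * (φ (s + t) / (s + t) ^ 2 * t ^ 2) := by
    rw [← mul_assoc, ← mul_div_assoc]
    refine mul_le_mul_of_nonneg_right ?_ (by positivity)
    rw [div_le_div_iff₀ hst (by positivity)]
    linarith [mul_le_mul_of_nonneg_right hu2 hst.le]
  have hX : 0 ≤ φ' (s + t) / (s + t) * t ^ 2 := by positivity
  have hY : 0 ≤ φ (s + t) / (s + t) ^ 2 * t ^ 2 := by positivity
  refine ⟨⟨?_, ?_⟩, ?_, ?_⟩
  · rwa [inv_mul_le_iff₀ hcpos]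
  · exact hupper.trans (le_mul_of_one_le_left hX (by linarith))
  · rw [inv_mul_le_iff₀ hcpos]
    exact hA.trans hlower
  · exact (hupper.trans hB).trans (mul_le_mul_of_nonneg_right hc hY)
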